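/- An edge v→w of a DAG G is reversible (i.e., replacing v→w by w→v yields a DAG that is Markov equivalent to G) if and only if Pa(v) = Pa(w)∖{v}, where Pa denotes the parent set in G. -/

import Mathlib

namespace CausalMEC

/-- A directed graph on `Fin n`, given by a Boolean edge function (`d a b = true` means `a → b`). -/
abbrev Dir (n : ℕ) := Fin n → Fin n → Bool

/-- Directed reachability (zero or more steps). -/
def Reach {n : ℕ} (d : Dir n) : Fin n → Fin n → Prop :=
  Relation.ReflTransGen fun a b => d a b = true

/-- No directed cycles (including no self-loops). -/
def Acyclic {n : ℕ} (d : Dir n) : Prop :=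
  ∀ v, ¬ Relation.TransGen (fun a b => d a b = true) v v

/-- A directed acyclic graph. -/
def IsDAG {n : ℕ} (d : Dir n) : Prop :=
  (∀ v, d v v = false) ∧ Acyclic d

/-- A directed (possibly cyclic) graph with edges between distinct vertices. -/
def IsDCG {n : ℕ} (d : Dir n) : Prop :=
  ∀ v, d v v = false

/-- The number of directed edges. -/
def edgeCount {n : ℕ} (d : Dir n) : ℕ :=
  (Finset.univ.filter fun q : Fin n × Fin n => d q.1 q.2 = true).card

/-- The parent set of a vertex. -/
def parents {n : ℕ} (d : Dir n) (v : Fin n) : Finset (Fin n) :=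
  Finset.univ.filter fun u => d u v = true

/-! ### Paths, d-connection and Markov equivalence in mixed graphs
A mixed graph is given by a directed part `d` and a bidirected part `b`. -/

/-- The kind of a step on a path: a directed edge traversed forwards, a directed edge
traversed backwards, or a bidirected edge. -/
inductive EdgeKind : Type
  | fwd | bwd | bidir
deriving DecidableEq

/-- Does the step point into its second endpoint? -/
def EdgeKind.intoSnd : EdgeKind → Bool
  | .fwd => true
  | .bwd => false
  | .bidir => true

/-- Does the step point into its first endpoint? -/
def EdgeKind.intoFst : EdgeKind → Bool
  | .fwd => false
  | .bwd => true
  | .bidir => true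

/-- A (possibly self-intersecting) path from `u` to `v` in the mixed graph `(d, b)`. -/
structure MPath {n : ℕ} (d b : Dir n) (u v : Fin n) where
  len : ℕ
  vert : Fin (len + 1) → Fin n
  kind : Fin len → EdgeKind
  first_eq : vert 0 = u
  last_eq : vert (Fin.last len) = v
  valid : ∀ i : Fin len,
    (kind i = .fwd → d (vert i.castSucc) (vert i.succ) = true) ∧
    (kind i = .bwd → d (vert i.succ) (vert i.castSucc) = true) ∧
    (kind i = .bidir → b (vert i.castSucc) (vert i.succ) = true)

/-- Whether the internal vertex at position `i` of a path is a collider. -/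
def MPath.colliderAt {n : ℕ} {d b : Dir n} {u v : Fin n} (π : MPath d b u v)
    (i : ℕ) (h1 : 0 < i) (h2 : i < π.len) : Bool :=
  (π.kind ⟨i - 1, by omega⟩).intoSnd && (π.kind ⟨i, h2⟩).intoFst

/-- A path is active given a conditioning set `Z` if every non-collider on it avoids `Z`
and every collider on it is in `Z` or has a descendant in `Z`. -/
def MPath.Active {n : ℕ} {d b : Dir n} {u v : Fin n} (π : MPath d b u v)
    (Z : Finset (Fin n)) : Prop :=
  ∀ (i : ℕ) (h1 : 0 < i) (h2 : i < π.len),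
    (π.colliderAt i h1 h2 = true →
      ∃ x ∈ Z, Reach d (π.vert ⟨i, by omega⟩) x) ∧
    (π.colliderAt i h1 h2 = false →
      π.vert ⟨i, by omega⟩ ∉ Z)

/-- d-connection given a conditioning set. -/
def DConn {n : ℕ} (d b : Dir n) (u v : Fin n) (Z : Finset (Fin n)) : Prop :=
  ∃ π : MPath d b u v, π.Active Z

/-- Markov equivalence of two mixed graphs: the same d-connection relations. -/
def MarkovEquiv {n : ℕ} (d b d' b' : Dir n) : Prop :=
  ∀ (u v : Fin n) (Z : Finset (Fin n)), u ≠ v → u ∉ Z → v ∉ Z →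
    (DConn d b u v Z ↔ DConn d' b' u v Z)

/-- The empty bidirected part: a purely directed graph. -/
def noBi (n : ℕ) : Dir n := fun _ _ => false

/-- Markov equivalence for purely directed graphs. -/
def MarkovEquivD {n : ℕ} (d d' : Dir n) : Prop :=
  MarkovEquiv d (noBi n) d' (noBi n)

/-- The Markov equivalence class of a DAG (within DAGs). -/
def MECdag {n : ℕ} (d : Dir n) : Set (Dir n) :=
  {d' | IsDAG d' ∧ MarkovEquivD d d'}

/-- An acyclic directed mixed graph. -/
def IsADMG {n : ℕ} (d b : Dir n) : Prop :=
  IsDAG d ∧ (∀ v w, b v w = b w v) ∧ (∀ v, b v v = false)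

/-- The Markov equivalence class of an ADMG (within ADMGs). -/
def MECadmg {n : ℕ} (d b : Dir n) : Set (Dir n × Dir n) :=
  {G | IsADMG G.1 G.2 ∧ MarkovEquiv d b G.1 G.2}

/-- The Markov equivalence class of a DCG (within DCGs). -/
def MECdcg {n : ℕ} (d : Dir n) : Set (Dir n) :=
  {d' | IsDCG d' ∧ MarkovEquivD d d'}

/-! ### The distribution `D(n,p)` and uniform ADMGs/DCGs -/

/-- The (unnormalized) weight of a DAG under `D(n,p)`. -/
noncomputable def dagWeight {n : ℕ} (p : ℝ) (d : Dir n) : ℝ :=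
  (p / (1 - p)) ^ edgeCount d

open scoped Classical in
/-- Probability of the event `A` under `D(n,p)`. -/
noncomputable def prD (n : ℕ) (p : ℝ) (A : Dir n → Prop) : ℝ :=
  (∑ d : Dir n, if IsDAG d ∧ A d then dagWeight p d else 0) /
    (∑ d : Dir n, if IsDAG d then dagWeight p d else 0)

open scoped Classical in
/-- Expectation of `f` under `D(n,p)`. -/
noncomputable def expD (n : ℕ) (p : ℝ) (f : Dir n → ℝ) : ℝ :=
  (∑ d : Dir n, if IsDAG d then f d * dagWeight p d else 0) /
    (∑ d : Dir n, if IsDAG d then dagWeight p d else 0)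

/-- Conditional probability of `A` given `B` under `D(n,p)`. -/
noncomputable def condPrD (n : ℕ) (p : ℝ) (A B : Dir n → Prop) : ℝ :=
  prD n p (fun d => A d ∧ B d) / prD n p B

open scoped Classical in
/-- Expectation of `f` under the uniform distribution on ADMGs on `n` vertices. -/
noncomputable def expADMG (n : ℕ) (f : Dir n × Dir n → ℝ) : ℝ :=
  (∑ G : Dir n × Dir n, if IsADMG G.1 G.2 then f G else 0) /
    (∑ G : Dir n × Dir n, if IsADMG G.1 G.2 then (1 : ℝ) else 0)

open scoped Classical in
/-- Expectation of `f` under the uniform distribution on DCGs on `n` vertices. -/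
noncomputable def expDCG (n : ℕ) (f : Dir n → ℝ) : ℝ :=
  (∑ d : Dir n, if IsDCG d then f d else 0) /
    (∑ d : Dir n, if IsDCG d then (1 : ℝ) else 0)

open scoped Classical in
/-- Probability of the event `A` under the uniform distribution on DCGs on `n` vertices. -/
noncomputable def prDCG (n : ℕ) (A : Dir n → Prop) : ℝ :=
  (∑ d : Dir n, if IsDCG d ∧ A d then (1 : ℝ) else 0) /
    (∑ d : Dir n, if IsDCG d then (1 : ℝ) else 0)

/-! ### Tower decomposition -/

/-- The sources of `d` within a vertex set `S` (no parents inside `S`). -/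
def sourcesIn {n : ℕ} (d : Dir n) (S : Finset (Fin n)) : Finset (Fin n) :=
  S.filter fun v => ∀ u ∈ S, d u v = false

/-- The vertices remaining after peeling off `k` layers of sources. -/
def remaining {n : ℕ} (d : Dir n) : ℕ → Finset (Fin n)
  | 0 => Finset.univ
  | k + 1 => remaining d k \ sourcesIn d (remaining d k)

/-- The `i`-th layer (1-based) of the tower decomposition of `d`. -/
def towerLayer {n : ℕ} (d : Dir n) (i : ℕ) : Finset (Fin n) :=
  sourcesIn d (remaining d (i - 1))

/-- The 1-based index of the layer containing `v`. -/
def layerIdx {n : ℕ} (d : Dir n) (v : Fin n) : ℕ :=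
  ((Finset.range n).filter fun j => v ∈ remaining d j).card

/-- The tower of a DAG: only the edges between adjacent layers are kept. -/
def tower {n : ℕ} (d : Dir n) : Dir n :=
  fun a c => d a c && decide (layerIdx d c = layerIdx d a + 1)

/-- `h` is the tower vector of `d` (layer sizes, 1-based, and no further layers). -/
def hasTowerVector {n : ℕ} (d : Dir n) (h : List ℕ) : Prop :=
  (∀ i : Fin h.length, (towerLayer d (i.val + 1)).card = h.get i) ∧
    towerLayer d (h.length + 1) = ∅

/-- `H` is the tower decomposition of `d`. -/
def hasTowerDecomp {n : ℕ} (d : Dir n) (H : List (Finset (Fin n))) : Prop :=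
  (∀ i : Fin H.length, towerLayer d (i.val + 1) = H.get i) ∧
    towerLayer d (H.length + 1) = ∅

/-- The weight `w(h)` of a tower vector `h = (h_1, …, h_s)`. -/
noncomputable def towerWeight (p : ℝ) (h : List ℕ) : ℝ :=
  (Nat.multinomial Finset.univ (fun i : Fin h.length => h.get i) : ℝ) *
    ∏ k ∈ Finset.Icc 2 h.length,
      (1 - (1 - p) ^ h.getD (k - 2) 0) ^ h.getD (k - 1) 0 /
        (1 - p) ^ (h.getD (k - 1) 0 * ∑ i ∈ Finset.range (k - 1), h.getD i 0)

/-! ### Edge reversal and deletion -/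

/-- Reverse the edge `v → w`. -/
def reverseEdge {n : ℕ} (d : Dir n) (v w : Fin n) : Dir n :=
  fun a c => if a = v ∧ c = w then false else if a = w ∧ c = v then true else d a c

/-- Delete the edge `v → w`. -/
def deleteEdge {n : ℕ} (d : Dir n) (v w : Fin n) : Dir n :=
  fun a c => if a = v ∧ c = w then false else d a c

/-- The edge `v → w` of a DAG is reversible: reversing it yields a Markov-equivalent DAG. -/
def Reversible {n : ℕ} (d : Dir n) (v w : Fin n) : Prop :=
  d v w = true ∧ IsDAG (reverseEdge d v w) ∧ MarkovEquivD d (reverseEdge d v w)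

/-- `d` has a matching of reversible layer-2-edges of size at least `m`. -/
def hasRevL2Matching {n : ℕ} (d : Dir n) (m : ℝ) : Prop :=
  ∃ S : Finset (Fin n × Fin n),
    (∀ e ∈ S, Reversible d e.1 e.2 ∧ e.2 ∈ towerLayer d 2) ∧
    (∀ e ∈ S, ∀ e' ∈ S, e ≠ e' →
      e.1 ≠ e'.1 ∧ e.1 ≠ e'.2 ∧ e.2 ≠ e'.1 ∧ e.2 ≠ e'.2) ∧
    m ≤ (S.card : ℝ)

/-! ### Cycles and the `Reverse` construction -/

/-- Cyclic successor in `Fin k`. -/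
def cycSucc {k : ℕ} (i : Fin k) : Fin k :=
  ⟨(i.val + 1) % k, Nat.mod_lt _ i.pos⟩

/-- The reversed parametrization of a cycle. -/
def cycRev {n k : ℕ} (c : Fin k → Fin n) : Fin k → Fin n :=
  fun i => c ⟨(k - i.val) % k, Nat.mod_lt _ i.pos⟩

/-- `c` lists the (distinct) vertices of a directed cycle of `d`, in order. -/
def IsCycle {n k : ℕ} (d : Dir n) (c : Fin k → Fin n) : Prop :=
  Function.Injective c ∧ ∀ i, d (c i) (c (cycSucc i)) = true

/-- The `Reverse(G, C)` construction: reverse the cycle `c` and redirect every edge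
`w → v_i` with `w ∈ Pa(v_i) \ {v_{i-1}}` to `w → v_{i-1}`. -/
def reverseCycle {n k : ℕ} (d : Dir n) (c : Fin k → Fin n) : Dir n :=
  fun a e =>
    decide ((∃ j : Fin k, e = c j ∧
        (a = c (cycSucc j) ∨ (d a (c (cycSucc j)) = true ∧ a ≠ c j))) ∨
      ((∀ j : Fin k, e ≠ c j) ∧ d a e = true))

/-- A vertex triple induces exactly a directed 3-cycle. -/
def induces3Cycle {n : ℕ} (d : Dir n) (W : Finset (Fin n)) : Prop :=
  ∃ a b c : Fin n, W = {a, b, c} ∧ a ≠ b ∧ a ≠ c ∧ b ≠ c ∧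
    d a b = true ∧ d b c = true ∧ d c a = true ∧
    d b a = false ∧ d c b = false ∧ d a c = false

/-- `Trail d Z u x b`: some walk of `d` from `u` to `x` has all its inner non-colliders outside `Z`
and all its inner colliders in `Z`, where `b` tells whether the last step points into `x`. The
trivial walk counts as leaving `u` on both sides, so `u` itself has to avoid `Z`. -/
inductive Trail {n : ℕ} (d : Dir n) (Z : Finset (Fin n)) (u : Fin n) : Fin n → Bool → Prop
  | refl : Trail d Z u u false
  | fwd {x y : Fin n} {b : Bool} :
      Trail d Z u x b → x ∉ Z → d x y = true → Trail d Z u y true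
  | bwd {x y : Fin n} : Trail d Z u x false → x ∉ Z → d y x = true → Trail d Z u y false
  | collider {x y : Fin n} : Trail d Z u x true → x ∈ Z → d y x = true → Trail d Z u y false

/-- A trail may turn around at an ancestor of `Z` lying outside `Z`. -/
lemma Trail.turn {n : ℕ} {d : Dir n} {Z : Finset (Fin n)} {u x z : Fin n} (hz : z ∈ Z)
    (hr : Reach d x z) (hx : x ∉ Z) (h : Trail d Z u x true) : Trail d Z u x false := by
  induction hr using Relation.ReflTransGen.head_induction_on with
  | refl => exact absurd hz hx
  | @head a c hac _ ih =>
    by_cases hc : c ∈ Z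
    · exact (h.fwd hx hac).collider hc hac
    · exact (ih hc (h.fwd hx hac)).bwd hc hac

lemma Trail.bwd_of_reach {n : ℕ} {d : Dir n} {Z : Finset (Fin n)} {u x y : Fin n}
    (h : Trail d Z u x true) (hz : ∃ z ∈ Z, Reach d x z) (hyx : d y x = true) :
    Trail d Z u y false := by
  obtain ⟨z, hz, hr⟩ := hz
  by_cases hx : x ∈ Z
  · exact h.collider hx hyx
  · exact (Trail.turn hz hr hx h).bwd hx hyx

lemma MPath.Active.trail {n : ℕ} {d : Dir n} {Z : Finset (Fin n)} {u v : Fin n}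
    {π : MPath d (noBi n) u v} (hπ : π.Active Z) (hu : u ∉ Z) (i : ℕ) (hi : i < π.len) :
    Trail d Z u (π.vert ⟨i + 1, by omega⟩) (π.kind ⟨i, hi⟩).intoSnd := by
  induction i with
  | zero =>
    obtain ⟨h1, h2, h3⟩ := π.valid ⟨0, hi⟩
    have h0 : π.vert (Fin.castSucc ⟨0, hi⟩) = u := π.first_eq
    rw [h0] at h1 h2 h3
    cases hk : π.kind ⟨0, hi⟩ with
    | fwd => exact Trail.refl.fwd hu (h1 hk)
    | bwd => exact Trail.refl.bwd hu (h2 hk)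
    | bidir => simp [noBi] at h3; exact absurd hk h3
  | succ i ih =>
    obtain ⟨h1, h2, h3⟩ := π.valid ⟨i + 1, hi⟩
    have ht := ih (by omega)
    obtain ⟨hc, hn⟩ := hπ (i + 1) (by omega) hi
    simp only [MPath.colliderAt, Nat.add_sub_cancel] at hc hn
    cases hk : π.kind ⟨i + 1, hi⟩ with
    | fwd =>
      rw [hk] at hn
      exact ht.fwd (hn (by simp [EdgeKind.intoFst])) (h1 hk)
    | bwd =>
      rw [hk] at hc hn
      cases hb : (π.kind ⟨i, by omega⟩).intoSnd with
      | false =>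
        rw [hb] at ht hn
        exact ht.bwd (hn (by simp)) (h2 hk)
      | true =>
        rw [hb] at ht hc
        exact ht.bwd_of_reach (hc (by simp [EdgeKind.intoFst])) (h2 hk)
    | bidir => simp [noBi] at h3; exact absurd hk h3

/-- A walk of `d` of length `L` with vertices `f` and step kinds `k`, active given `Z`. -/
def IsActiveWalk {n : ℕ} (d : Dir n) (Z : Finset (Fin n)) (L : ℕ) (f : ℕ → Fin n)
    (k : ℕ → EdgeKind) : Prop :=
  (∀ i < L, (k i = .fwd ∧ d (f i) (f (i + 1)) = true) ∨
    (k i = .bwd ∧ d (f (i + 1)) (f i) = true)) ∧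
  ∀ i, i + 1 < L → (((k i).intoSnd && (k (i + 1)).intoFst) = true → f (i + 1) ∈ Z) ∧
    (((k i).intoSnd && (k (i + 1)).intoFst) = false → f (i + 1) ∉ Z)

lemma IsActiveWalk.dConn {n : ℕ} {d : Dir n} {Z : Finset (Fin n)} {L : ℕ} {f : ℕ → Fin n}
    {k : ℕ → EdgeKind} (h : IsActiveWalk d Z L f k) : DConn d (noBi n) (f 0) (f L) Z := by
  refine ⟨⟨L, fun i => f i, fun i => k i, rfl, rfl, fun i => ?_⟩, fun i h1 h2 => ?_⟩
  · rcases h.1 i i.2 with ⟨hk, he⟩ | ⟨hk, he⟩ <;> simpa [hk] using he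
  · obtain ⟨i, rfl⟩ : ∃ j, i = j + 1 := ⟨i - 1, by omega⟩
    exact ⟨fun hc => ⟨_, (h.2 i h2).1 hc, .refl⟩, (h.2 i h2).2⟩

lemma IsActiveWalk.snoc {n : ℕ} {d : Dir n} {Z : Finset (Fin n)} {L : ℕ} {f : ℕ → Fin n}
    {k : ℕ → EdgeKind} (h : IsActiveWalk d Z L f k) {y : Fin n} {e : EdgeKind}
    (he : (e = .fwd ∧ d (f L) y = true) ∨ (e = .bwd ∧ d y (f L) = true))
    (hc : ∀ i, L = i + 1 → (((k i).intoSnd && e.intoFst) = true → f L ∈ Z) ∧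
      (((k i).intoSnd && e.intoFst) = false → f L ∉ Z)) :
    IsActiveWalk d Z (L + 1) (fun i => if i ≤ L then f i else y)
      (fun i => if i < L then k i else e) := by
  constructor
  · intro i hi
    rcases Nat.lt_succ_iff_lt_or_eq.mp hi with hi | rfl
    · simpa [hi, hi.le, Nat.succ_le_of_lt hi] using h.1 i hi
    · simpa using he
  · intro i hi
    have hi' : i < L := by omega
    rcases Nat.lt_succ_iff_lt_or_eq.mp hi with hi | hi
    · simpa [hi, hi', Nat.succ_le_of_lt hi'] using h.2 i hi
    · subst hi
      simpa using hc i rfl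

lemma Trail.exists_isActiveWalk {n : ℕ} {d : Dir n} {Z : Finset (Fin n)} {u x : Fin n} {b : Bool}
    (h : Trail d Z u x b) :
    ∃ L f k, IsActiveWalk d Z L f k ∧ f 0 = u ∧ f L = x ∧ (L = 0 → b = false) ∧
      ∀ i, L = i + 1 → (k i).intoSnd = b := by
  induction h with
  | refl => exact ⟨0, fun _ => u, fun _ => .fwd, by simp [IsActiveWalk], rfl, rfl, by simp, by simp⟩
  | fwd _ hx hxy ih =>
    obtain ⟨L, f, k, hw, h0, rfl, -, hk⟩ := ih
    refine ⟨L + 1, _, _, hw.snoc (.inl ⟨rfl, hxy⟩) fun i hi => ?_, by simpa, by simp, by simp, ?_⟩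
    · simp [EdgeKind.intoFst, hx]
    · simp +contextual [EdgeKind.intoSnd]
  | bwd _ hx hyx ih =>
    obtain ⟨L, f, k, hw, h0, rfl, -, hk⟩ := ih
    refine ⟨L + 1, _, _, hw.snoc (.inr ⟨rfl, hyx⟩) fun i hi => ?_, by simpa, by simp, by simp, ?_⟩
    · simp [hk i hi, hx]
    · simp +contextual [EdgeKind.intoSnd]
  | collider _ hx hyx ih =>
    obtain ⟨L, f, k, hw, h0, rfl, -, hk⟩ := ih
    refine ⟨L + 1, _, _, hw.snoc (.inr ⟨rfl, hyx⟩) fun i hi => ?_, by simpa, by simp, by simp, ?_⟩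
    · simp [EdgeKind.intoFst, hk i hi, hx]
    · simp +contextual [EdgeKind.intoSnd]

lemma dConn_iff_trail {n : ℕ} {d : Dir n} {Z : Finset (Fin n)} {u v : Fin n} (hu : u ∉ Z) :
    DConn d (noBi n) u v Z ↔ ∃ b, Trail d Z u v b := by
  constructor
  · rintro ⟨π, hπ⟩
    rcases Nat.eq_zero_or_pos π.len with h0 | hpos
    · have huv : u = v := by
        refine π.first_eq.symm.trans (Eq.trans ?_ π.last_eq)
        congr 1
        ext
        simp [h0]
      exact ⟨false, huv ▸ .refl⟩
    · refine ⟨(π.kind ⟨π.len - 1, by omega⟩).intoSnd, ?_⟩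
      convert hπ.trail hu (π.len - 1) (by omega)
      refine π.last_eq.symm.trans ?_
      congr 1
      ext
      simp
      omega
  · rintro ⟨b, h⟩
    obtain ⟨L, f, k, hw, rfl, rfl, -⟩ := h.exists_isActiveWalk
    exact hw.dConn

/-- The parents of `w` separate it from every other non-descendant. -/
lemma Trail.of_parents {n : ℕ} {d : Dir n} (hd : Acyclic d) {w x : Fin n} {b : Bool}
    (h : Trail d (parents d w) w x b) :
    (b = true ∧ Relation.TransGen (fun a c => d a c = true) w x) ∨
      (b = false ∧ (x = w ∨ d x w = true)) := by
  induction h with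
  | refl => simp
  | fwd _ hx hxy ih =>
    left
    refine ⟨rfl, ?_⟩
    rcases ih with ⟨-, h⟩ | ⟨-, rfl | h⟩
    · exact h.tail hxy
    · exact .single hxy
    · exact absurd h (by simpa [parents] using hx)
  | bwd _ hx hyx ih =>
    right
    rcases ih with ⟨h, -⟩ | ⟨-, rfl | h⟩
    · cases h
    · exact ⟨rfl, .inr hyx⟩
    · exact absurd h (by simpa [parents] using hx)
  | collider _ hx _ ih =>
    rcases ih with ⟨-, h⟩ | ⟨h, -⟩
    · exact absurd (h.tail (by simpa [parents] using hx)) (hd w)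
    · cases h

/-- If the chain `p → v → w` of `d` is a collider `p → v ← w` in a Markov equivalent graph,
then `p → w` in `d`. -/
lemma MarkovEquivD.edge_of_chain {n : ℕ} {d d' : Dir n} (hd : Acyclic d)
    (h : MarkovEquivD d d') {p v w : Fin n} (hpv : d p v = true) (hvw : d v w = true)
    (hpv' : d' p v = true) (hwv' : d' w v = true) : d p w = true := by
  by_contra hpw
  have hpw' : w ≠ p := by
    rintro rfl
    exact hd w (.tail (.single hpv) hvw)
  have hw : w ∉ parents d w := by
    simpa [parents] using fun hww : d w w = true => hd w (.single hww)
  have hv : v ∈ parents d w := by simpa [parents] using hvw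
  have hconn : DConn d' (noBi n) w p (parents d w) :=
    (dConn_iff_trail hw).2 ⟨_, ((Trail.refl.fwd hw hwv').collider hv hpv')⟩
  obtain ⟨b, hb⟩ := (dConn_iff_trail hw).1
    ((h w p (parents d w) hpw' hw (by simpa [parents] using hpw)).2 hconn)
  rcases hb.of_parents hd with ⟨-, ht⟩ | ⟨-, rfl | hp⟩
  · exact hd w ((ht.tail hpv).tail hvw)
  · exact hpw' rfl
  · exact hpw hp

/-- `d'` arises from `d` by reversing the edge `v → w`, whose endpoints have the same other
parents. -/
structure CoveredReversal {n : ℕ} (d d' : Dir n) (v w : Fin n) : Prop where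
  ne : v ≠ w
  edge : d v w = true
  not_rev : d w v = false
  edge' : d' w v = true
  not_rev' : d' v w = false
  irrefl_left : d v v = false
  irrefl_right : d w w = false
  parents_eq : ∀ p, p ≠ v → p ≠ w → d p v = d p w
  agree : ∀ a c, (a = v → c ≠ w) → (a = w → c ≠ v) → d' a c = d a c

lemma CoveredReversal.symm {n : ℕ} {d d' : Dir n} {v w : Fin n} (h : CoveredReversal d d' v w) :
    CoveredReversal d' d w v where
  ne := h.ne.symm
  edge := h.edge'
  not_rev := h.not_rev'
  edge' := h.edge
  not_rev' := h.not_rev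
  irrefl_left := by rw [h.agree _ _ (by grind [h.ne]) (by grind [h.ne]), h.irrefl_right]
  irrefl_right := by rw [h.agree _ _ (by grind [h.ne]) (by grind [h.ne]), h.irrefl_left]
  parents_eq p hw hv := by
    rw [h.agree _ _ (by grind) (by grind), h.agree _ _ (by grind) (by grind), h.parents_eq p hv hw]
  agree a c h1 h2 := (h.agree a c h2 h1).symm

lemma CoveredReversal.trail {n : ℕ} {d d' : Dir n} {v w : Fin n} (h : CoveredReversal d d' v w)
    {Z : Finset (Fin n)} {u x : Fin n} {b : Bool} (hu : u ∉ Z) (hx : x ∉ Z)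
    (ht : Trail d Z u x b) : ∃ b', Trail d' Z u x b' := by
  obtain ⟨hne, e1, e2, e3, e4, e5, e6, hp, ha⟩ := h
  by_cases hv : v ∈ Z <;> by_cases hw : w ∈ Z
  · have key : (x ≠ v → x ≠ w → Trail d' Z u x b) ∧
        (b = true → Trail d' Z u x true) := by
      clear hx
      induction ht <;> grind [Trail]
    grind
  · have key : (x ≠ v → x ≠ w → Trail d' Z u x b) ∧
        (x = v → b = true → Trail d' Z u v true ∧ Trail d' Z u w true) ∧
        (x = w → Trail d' Z u w b) := by
      clear hx
      induction ht <;> grind [Trail]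
    grind
  · have key : (x ≠ v → x ≠ w → Trail d' Z u x b) ∧
        (x = v ∨ x = w ∧ b = true →
          Trail d' Z u v false ∨ (Trail d' Z u v true ∧ Trail d' Z u w true)) := by
      clear hx
      induction ht <;> grind [Trail]
    grind
  · have key : (x ≠ v → x ≠ w → Trail d' Z u x b) ∧
        (x = v → b = false → Trail d' Z u w false) ∧
        (x = v → b = true → Trail d' Z u v true ∧ Trail d' Z u w true) ∧
        (x = w → Trail d' Z u w false ∨ (b = true ∧ Trail d' Z u w true)) := by
      clear hx
      induction ht <;> grind [Trail]
    grind [Trail]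

lemma CoveredReversal.markovEquivD {n : ℕ} {d d' : Dir n} {v w : Fin n}
    (h : CoveredReversal d d' v w) : MarkovEquivD d d' := by
  intro a c Z _ ha hc
  rw [dConn_iff_trail ha, dConn_iff_trail ha]
  exact ⟨fun ⟨_, ht⟩ => h.trail ha hc ht, fun ⟨_, ht⟩ => h.symm.trail ha hc ht⟩

lemma CoveredReversal.acyclic {n : ℕ} {d d' : Dir n} {v w : Fin n}
    (h : CoveredReversal d d' v w) (hd : Acyclic d) : Acyclic d' := by
  have descend : ∀ x, Relation.TransGen (fun a c => d' a c = true) v x →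
      Relation.TransGen (fun a c => d a c = true) v x ∧ x ≠ w := by
    intro x hx
    induction hx with
    | single he =>
      have := h.ne
      have := h.not_rev'
      exact ⟨.single (by grind [h.agree]), by grind⟩
    | @tail x y _ he ih =>
      obtain ⟨hvx, hxw⟩ := ih
      have hxv : x ≠ v := by
        rintro rfl
        exact hd x hvx
      have hxy : d x y = true := by rw [← he, h.agree x y (by grind) (by grind)]
      refine ⟨hvx.tail hxy, ?_⟩
      rintro rfl
      exact hd v (hvx.tail (by rw [h.parents_eq x hxv hxw, hxy]))
  have hvv : ¬ Relation.TransGen (fun a c => d' a c = true) v v := fun hc => hd v (descend v hc).1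
  have split : ∀ a c, Relation.TransGen (fun a c => d' a c = true) a c →
      Relation.TransGen (fun a c => d a c = true) a c ∨
        (Relation.TransGen (fun a c => d' a c = true) a v ∧
          Relation.ReflTransGen (fun a c => d' a c = true) v c) := by
    intro a c hac
    induction hac with
    | @single c he =>
      by_cases hc : c = v
      · subst hc
        exact .inr ⟨.single he, .refl⟩
      · refine .inl (.single ?_)
        rw [← he, h.agree a c (by grind [h.not_rev']) (by grind)]
    | @tail x c hax he ih =>
      rcases ih with ih | ⟨h1, h2⟩
      · by_cases hc : c = v
        · subst hc
          exact .inr ⟨hax.tail he, .refl⟩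
        · refine .inl (ih.tail ?_)
          rw [← he, h.agree x c (by grind [h.not_rev']) (by grind)]
      · exact .inr ⟨h1, h2.tail he⟩
  intro a ha
  rcases split a a ha with h1 | ⟨h1, h2⟩
  · exact hd a h1
  · exact hvv (h1.trans_right h2)

/-- Lemma 2.3, Chickering: an edge `v → w` of a DAG `d` is reversible
(its reversal is a DAG Markov equivalent to `d`) iff `Pa(v) = Pa(w) \ {v}`. -/
theorem reversible_edge_characterization (n : ℕ) (d : Dir n) (hd : IsDAG d)
    (v w : Fin n) (hvw : d v w = true) :
    (IsDAG (reverseEdge d v w) ∧ MarkovEquivD d (reverseEdge d v w)) ↔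
      parents d v = (parents d w).erase v := by
  have hne : v ≠ w := by
    rintro rfl
    exact hd.2 v (.single hvw)
  have hwv : d w v = false := by
    by_contra hwv
    exact hd.2 v (.tail (.single hvw) (by simpa using hwv))
  have hv := hd.1 v
  have hw := hd.1 w
  have hwv' : reverseEdge d v w w v = true := by simp [reverseEdge, hne.symm]
  constructor
  · rintro ⟨hd', he⟩
    have he' : MarkovEquivD (reverseEdge d v w) d :=
      fun a c Z h1 h2 h3 => (he a c Z h1 h2 h3).symm
    ext p
    simp only [parents, Finset.mem_filter, Finset.mem_univ, true_and, Finset.mem_erase]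
    constructor
    · intro hp
      have hpv : p ≠ v := by grind
      exact ⟨hpv, he.edge_of_chain hd.2 hp hvw (by grind [reverseEdge]) hwv'⟩
    · rintro ⟨hpv, hp⟩
      have hpv' := he'.edge_of_chain hd'.2 (p := p) (by grind [reverseEdge]) hwv' hp hvw
      grind [reverseEdge]
  · intro hpar
    have hcov : CoveredReversal d (reverseEdge d v w) v w := by
      refine ⟨hne, hvw, hwv, hwv', by simp [reverseEdge], hv, hw, fun p hpv hpw => ?_,
        by grind [reverseEdge]⟩
      have := Finset.ext_iff.1 hpar p
      simp only [parents, Finset.mem_filter, Finset.mem_univ, true_and, Finset.mem_erase] at this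
      grind
    exact ⟨⟨by grind [reverseEdge, hd.1], hcov.acyclic hd.2⟩, hcov.markovEquivD⟩

end CausalMEC
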